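/- (Elsässer form of the ideal LAMHD-α equations.) Let u_s, B_s, π solve the LAMHD-α system with ν = η = 0. Define the Elsässer fields z± = u ± B and z_s± = u_s ± B_s, the scalar field π̃ = π + ½|u_s|² + (α²/2)|∇u_s|² + ½(1−α²Δ)|B_s|² + (α²/2)|∇B_s|², and the matrix fields ς± = (∇u_s)ᵀ·∇u_s − (∇B_s)ᵀ·∇B_s ± ( ∇B_s·∇u_s + ∇B_s·(∇u_s)ᵀ − ∇u_s·∇B_s − ∇u_s·(∇B_s)ᵀ ). Then for each choice of sign, at every point, ∂_t z± + (z_s∓·∇)z± + ∇π̃ = α² div ς±. -/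

import Mathlib

open Matrix MeasureTheory

noncomputable section

abbrev V3 := Fin 3 → ℝ

/-- Partial derivative `∂_j f` of a scalar field on ℝ³. -/
def pd (j : Fin 3) (f : V3 → ℝ) (x : V3) : ℝ := fderiv ℝ f x (Pi.single j 1)

/-- Jacobian matrix field: `(∇f)_{ij} = ∂f_i/∂x_j`. -/
def grad (f : V3 → V3) (x : V3) : Matrix (Fin 3) (Fin 3) ℝ :=
  Matrix.of fun i j => pd j (fun y => f y i) x

/-- Divergence of a vector field. -/
def divV (f : V3 → V3) (x : V3) : ℝ := ∑ j, pd j (fun y => f y j) x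

/-- Divergence of a matrix field: `(div M)_i = Σ_j ∂_j M_{ij}`. -/
def divM (M : V3 → Matrix (Fin 3) (Fin 3) ℝ) (x : V3) (i : Fin 3) : ℝ :=
  ∑ j, pd j (fun y => M y i j) x

/-- Scalar Laplacian. -/
def lapS (φ : V3 → ℝ) (x : V3) : ℝ := ∑ j, pd j (fun y => pd j φ y) x

/-- Componentwise Laplacian of a vector field. -/
def lap (f : V3 → V3) (x : V3) (i : Fin 3) : ℝ := lapS (fun y => f y i) x

/-- Helmholtz operator `(1 - α²Δ)` on vector fields. -/
def helm (α : ℝ) (f : V3 → V3) (x : V3) (i : Fin 3) : ℝ := f x i - α ^ 2 * lap f x i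

/-- Helmholtz operator `(1 - α²Δ)` on scalar fields. -/
def helmS (α : ℝ) (φ : V3 → ℝ) (x : V3) : ℝ := φ x - α ^ 2 * lapS φ x

/-- Advection `(g·∇)f = Σ_j g_j ∂_j f`. -/
def advect (g f : V3 → V3) (x : V3) (i : Fin 3) : ℝ :=
  ∑ j, g x j * pd j (fun y => f y i) x

/-- `(∇f)ᵀ·g`, pointwise matrix-vector product. -/
def gradTvec (f g : V3 → V3) (x : V3) (i : Fin 3) : ℝ :=
  ∑ j, (grad f x)ᵀ i j * g x j

/-- Gradient of a scalar field. -/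
def gradS (φ : V3 → ℝ) (x : V3) (i : Fin 3) : ℝ := pd i φ x

/-- Pointwise squared Euclidean norm `|f|²`. -/
def normSq (f : V3 → V3) (x : V3) : ℝ := ∑ i, (f x i) ^ 2

/-- Squared Frobenius norm of the Jacobian, `|∇f|²`. -/
def gradNormSq (f : V3 → V3) (x : V3) : ℝ := ∑ i, ∑ j, (grad f x i j) ^ 2

/-- Spatial tslice at time `t` of a time-dependent vector field. -/
def tslice (f : ℝ × V3 → V3) (t : ℝ) : V3 → V3 := fun x => f (t, x)

open scoped ContDiff

section PartialDerivatives

variable {f g : V3 → ℝ}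

@[fun_prop]
theorem ContDiff.pd (j : Fin 3) (hf : ContDiff ℝ ∞ f) : ContDiff ℝ ∞ (fun x => pd j f x) :=
  (hf.fderiv_right (m := ∞) (by simp)).clm_apply contDiff_const

theorem pd_add (j : Fin 3) (x : V3) (hf : ContDiff ℝ ∞ f) (hg : ContDiff ℝ ∞ g) :
    pd j (fun y => f y + g y) x = pd j f x + pd j g x := by
  unfold pd
  rw [fderiv_fun_add (hf.differentiable (by simp) x) (hg.differentiable (by simp) x)]
  rfl

theorem pd_sub (j : Fin 3) (x : V3) (hf : ContDiff ℝ ∞ f) (hg : ContDiff ℝ ∞ g) :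
    pd j (fun y => f y - g y) x = pd j f x - pd j g x := by
  unfold pd
  rw [fderiv_fun_sub (hf.differentiable (by simp) x) (hg.differentiable (by simp) x)]
  rfl

theorem pd_mul (j : Fin 3) (x : V3) (hf : ContDiff ℝ ∞ f) (hg : ContDiff ℝ ∞ g) :
    pd j (fun y => f y * g y) x = f x * pd j g x + g x * pd j f x := by
  unfold pd
  rw [fderiv_fun_mul (hf.differentiable (by simp) x) (hg.differentiable (by simp) x)]
  rfl

theorem pd_const (j : Fin 3) (x : V3) (c : ℝ) : pd j (fun _ => c) x = 0 := by
  simp [pd]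

theorem pd_comm (i j : Fin 3) (hf : ContDiff ℝ ∞ f) : pd i (pd j f) = pd j (pd i f) := by
  funext x
  have hd : DifferentiableAt ℝ (fderiv ℝ f) x :=
    (hf.fderiv_right (m := ∞) (by simp)).differentiable (by simp) x
  have hs : IsSymmSndFDerivAt ℝ f x :=
    hf.contDiffAt.isSymmSndFDerivAt (by simpa using ENat.LEInfty.out)
  change fderiv ℝ (fun y => fderiv ℝ f y (Pi.single j 1)) x _ =
    fderiv ℝ (fun y => fderiv ℝ f y (Pi.single i 1)) x _
  rw [fderiv_clm_apply hd (differentiableAt_const _),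
    fderiv_clm_apply hd (differentiableAt_const _)]
  simpa using hs _ _

end PartialDerivatives

section TimeDerivatives

variable {F : ℝ × V3 → ℝ}

theorem pd_slice_eq_fderiv (hF : ContDiff ℝ ∞ F) (j : Fin 3) (t : ℝ) (x : V3) :
    pd j (fun y => F (t, y)) x = fderiv ℝ F (t, x) (0, Pi.single j 1) := by
  have h := ((hF.differentiable (by simp) (t, x)).hasFDerivAt).comp x (hasFDerivAt_prodMk_right t x)
  change fderiv ℝ (F ∘ fun y => (t, y)) x _ = _
  rw [h.fderiv]
  simp

theorem deriv_slice_eq_fderiv (hF : ContDiff ℝ ∞ F) (t : ℝ) (x : V3) :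
    deriv (fun s => F (s, x)) t = fderiv ℝ F (t, x) (1, 0) := by
  have h := ((hF.differentiable (by simp) (t, x)).hasFDerivAt).comp t
    (hasFDerivAt_prodMk_left (𝕜 := ℝ) t x)
  change deriv (F ∘ fun s => (s, x)) t = _
  rw [h.hasDerivAt.deriv]
  simp

theorem ContDiff.pd_slice (hF : ContDiff ℝ ∞ F) (j : Fin 3) :
    ContDiff ℝ ∞ (fun p : ℝ × V3 => _root_.pd j (fun y => F (p.1, y)) p.2) := by
  simp only [pd_slice_eq_fderiv hF]
  exact (hF.fderiv_right (m := ∞) (by simp)).clm_apply contDiff_const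

theorem ContDiff.lapS_slice (hF : ContDiff ℝ ∞ F) :
    ContDiff ℝ ∞ (fun p : ℝ × V3 => lapS (fun y => F (p.1, y)) p.2) :=
  ContDiff.sum fun j _ => (hF.pd_slice j).pd_slice j

theorem ContDiff.helmS_slice (hF : ContDiff ℝ ∞ F) (α : ℝ) :
    ContDiff ℝ ∞ (fun p : ℝ × V3 => helmS α (fun y => F (p.1, y)) p.2) :=
  hF.sub (contDiff_const.mul hF.lapS_slice)

theorem ContDiff.differentiableAt_slice (hF : ContDiff ℝ ∞ F) (t : ℝ) (x : V3) :
    DifferentiableAt ℝ (fun s => F (s, x)) t :=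
  (hF.comp (contDiff_id.prodMk contDiff_const)).differentiable (by simp) t

theorem deriv_pd_slice (hF : ContDiff ℝ ∞ F) (j : Fin 3) (t : ℝ) (x : V3) :
    deriv (fun s => pd j (fun y => F (s, y)) x) t =
      pd j (fun y => deriv (fun s => F (s, y)) t) x := by
  have hd := hF.fderiv_right (m := ∞) (by simp)
  have hs : IsSymmSndFDerivAt ℝ F (t, x) :=
    hF.contDiffAt.isSymmSndFDerivAt (by simpa using ENat.LEInfty.out)
  have hD (v : ℝ × V3) : ContDiff ℝ ∞ fun p => fderiv ℝ F p v := hd.clm_apply contDiff_const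
  have hD' (v w : ℝ × V3) : fderiv ℝ (fun p => fderiv ℝ F p v) (t, x) w =
      fderiv ℝ (fderiv ℝ F) (t, x) w v := by
    rw [fderiv_clm_apply (hd.differentiable (by simp) _) (differentiableAt_const _)]
    simp
  simp only [pd_slice_eq_fderiv hF, deriv_slice_eq_fderiv hF]
  rw [deriv_slice_eq_fderiv (hD _), pd_slice_eq_fderiv (hD _), hD', hD', hs]

theorem deriv_helmS_slice (hF : ContDiff ℝ ∞ F) (α t : ℝ) (x : V3) :
    deriv (fun s => helmS α (fun y => F (s, y)) x) t =
      helmS α (fun y => deriv (fun s => F (s, y)) t) x := by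
  have hpd (j : Fin 3) := (hF.pd_slice j).pd_slice j
  unfold helmS
  rw [deriv_fun_sub (hF.differentiableAt_slice t x)
    ((hF.lapS_slice.differentiableAt_slice t x).const_mul _),
    deriv_const_mul _ (hF.lapS_slice.differentiableAt_slice t x)]
  unfold lapS
  rw [deriv_fun_sum fun j _ => (hpd j).differentiableAt_slice t x]
  simp only [deriv_pd_slice (hF.pd_slice _), deriv_pd_slice hF]

end TimeDerivatives

section SpatialIdentities

variable {u b : V3 → V3}

theorem normSq_eq (f : V3 → V3) : normSq f = fun x => ∑ i, f x i ^ 2 := rfl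

theorem elsasser_gradient_identity (hu : ∀ i, ContDiff ℝ ∞ fun y => u y i)
    (hb : ∀ i, ContDiff ℝ ∞ fun y => b y i) (α : ℝ) (x : V3) (i : Fin 3) :
    gradS (fun y => (1 / 2) * normSq u y + (α ^ 2 / 2) * gradNormSq u y
        + (1 / 2) * helmS α (normSq b) y + (α ^ 2 / 2) * gradNormSq b y) x i
      = gradTvec u (helm α u) x i + gradTvec (helm α b) b x i
        + α ^ 2 * divM (fun y => (grad u y)ᵀ * grad u y - (grad b y)ᵀ * grad b y) x i := by
  simp only [gradS, gradTvec, divM, normSq_eq, gradNormSq, helmS, helm, lap, lapS, grad,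
    Fin.sum_univ_three, pow_two, Matrix.mul_apply, Matrix.sub_apply, Matrix.transpose_apply,
    Matrix.of_apply]
  simp (disch := fun_prop) only [pd_add, pd_sub, pd_mul, pd_const]
  eta_reduce
  simp (disch := fun_prop) only [pd_comm]
  ring

theorem helmS_advect_sub_advect (hu : ∀ i, ContDiff ℝ ∞ fun y => u y i)
    (hb : ∀ i, ContDiff ℝ ∞ fun y => b y i) (hdivu : ∀ x, divV u x = 0)
    (hdivb : ∀ x, divV b x = 0) (α : ℝ) (x : V3) (i : Fin 3) :
    helmS α (fun y => advect b u y i - advect u b y i) x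
        + advect u (helm α b) x i - advect b (helm α u) x i
      = α ^ 2 * divM (fun y => grad b y * grad u y + grad b y * (grad u y)ᵀ
          - grad u y * grad b y - grad u y * (grad b y)ᵀ) x i := by
  have hu' (k : Fin 3) : pd k (fun y => divV u y) x = 0 := by simp only [hdivu, pd_const]
  have hb' (k : Fin 3) : pd k (fun y => divV b y) x = 0 := by simp only [hdivb, pd_const]
  simp only [divV, Fin.sum_univ_three] at hu' hb'
  simp (disch := fun_prop) only [pd_add] at hu' hb'
  have hu0 := hu' 0
  have hu1 := hu' 1
  have hu2 := hu' 2
  have hb0 := hb' 0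
  have hb1 := hb' 1
  have hb2 := hb' 2
  simp only [divM, advect, helmS, helm, lap, lapS, grad,
    Fin.sum_univ_three, pow_two, Matrix.mul_apply, Matrix.sub_apply, Matrix.add_apply,
    Matrix.transpose_apply, Matrix.of_apply]
  simp (disch := fun_prop) only [pd_add, pd_sub, pd_mul, pd_const]
  eta_reduce at hu0 hu1 hu2 hb0 hb1 hb2 ⊢
  simp (disch := fun_prop) only [pd_comm] at hu0 hu1 hu2 hb0 hb1 hb2 ⊢
  linear_combination α ^ 2 *
    (-pd 0 (fun y => b y i) x * hu0 - pd 1 (fun y => b y i) x * hu1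
      - pd 2 (fun y => b y i) x * hu2 + pd 0 (fun y => u y i) x * hb0
      + pd 1 (fun y => u y i) x * hb1 + pd 2 (fun y => u y i) x * hb2)

theorem advect_sub_add {U B : V3 → V3} (hU : ∀ i, ContDiff ℝ ∞ fun y => U y i)
    (hB : ∀ i, ContDiff ℝ ∞ fun y => B y i) (ε : ℝ) (x : V3) (i : Fin 3) :
    advect (fun y j => u y j - ε * b y j) (fun y j => U y j + ε * B y j) x i
      = advect u U x i - ε ^ 2 * advect b B x i + ε * (advect u B x i - advect b U x i) := by
  simp only [advect, Fin.sum_univ_three]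
  simp (disch := fun_prop) only [pd_add, pd_mul, pd_const]
  ring

theorem divM_add_smul {M N : V3 → Matrix (Fin 3) (Fin 3) ℝ}
    (hM : ∀ i j, ContDiff ℝ ∞ fun y => M y i j) (hN : ∀ i j, ContDiff ℝ ∞ fun y => N y i j)
    (ε : ℝ) (x : V3) (i : Fin 3) :
    divM (fun y => M y + ε • N y) x i = divM M x i + ε * divM N x i := by
  simp only [divM, Fin.sum_univ_three, Matrix.add_apply, Matrix.smul_apply, smul_eq_mul]
  simp (disch := fun_prop) only [pd_add, pd_mul, pd_const]
  ring

end SpatialIdentities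

/-- Elsässer form of the ideal LAMHD-α equations.  The sign `ε = ±1`
encodes the two Elsässer fields `z± = u ± B`, with `z_s∓ = u_s ∓ B_s`. -/
theorem lamhd_elsasser_form (α : ℝ) (hα : 0 ≤ α) (us Bs : ℝ × V3 → V3) (pres : ℝ × V3 → ℝ)
    (hus : ContDiff ℝ (⊤ : ℕ∞) us) (hBs : ContDiff ℝ (⊤ : ℕ∞) Bs) (hpres : ContDiff ℝ (⊤ : ℕ∞) pres)
    (hdivu : ∀ t : ℝ, ∀ x : V3, divV (tslice us t) x = 0)
    (hdivB : ∀ t : ℝ, ∀ x : V3, divV (tslice Bs t) x = 0)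
    (hmotion : ∀ t : ℝ, ∀ x : V3, ∀ i : Fin 3,
      deriv (fun s => helm α (tslice us s) x i) t
        + advect (tslice us t) (helm α (tslice us t)) x i
        - advect (tslice Bs t) (helm α (tslice Bs t)) x i
        + gradTvec (tslice us t) (helm α (tslice us t)) x i
        + gradTvec (helm α (tslice Bs t)) (tslice Bs t) x i
        + gradS (fun y => pres (t, y)) x i = 0)
    (hinduction : ∀ t : ℝ, ∀ x : V3, ∀ i : Fin 3,
      deriv (fun s => Bs (s, x) i) t
        + advect (tslice us t) (tslice Bs t) x i
        - advect (tslice Bs t) (tslice us t) x i = 0) :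
    ∀ ε : ℝ, (ε = 1 ∨ ε = -1) →
      ∀ t : ℝ, ∀ x : V3, ∀ i : Fin 3,
        deriv (fun s => helm α (tslice us s) x i + ε * helm α (tslice Bs s) x i) t
          + advect (fun y j => us (t, y) j - ε * Bs (t, y) j)
              (fun y j => helm α (tslice us t) y j + ε * helm α (tslice Bs t) y j) x i
          + gradS (fun y => pres (t, y)
              + (1 / 2) * normSq (tslice us t) y + (α ^ 2 / 2) * gradNormSq (tslice us t) y
              + (1 / 2) * helmS α (normSq (tslice Bs t)) y
              + (α ^ 2 / 2) * gradNormSq (tslice Bs t) y) x i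
        = α ^ 2 * divM (fun y =>
            (grad (tslice us t) y)ᵀ * grad (tslice us t) y
            - (grad (tslice Bs t) y)ᵀ * grad (tslice Bs t) y
            + ε • (grad (tslice Bs t) y * grad (tslice us t) y
                + grad (tslice Bs t) y * (grad (tslice us t) y)ᵀ
                - grad (tslice us t) y * grad (tslice Bs t) y
                - grad (tslice us t) y * (grad (tslice Bs t) y)ᵀ)) x i := by
  intro ε hε t x i
  have hε2 : ε ^ 2 = 1 := by rcases hε with rfl | rfl <;> norm_num
  have hus' (j : Fin 3) : ContDiff ℝ ∞ fun p => us p j := contDiff_pi.mp hus j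
  have hBs' (j : Fin 3) : ContDiff ℝ ∞ fun p => Bs p j := contDiff_pi.mp hBs j
  have hslice {F : ℝ × V3 → ℝ} (hF : ContDiff ℝ ∞ F) : ContDiff ℝ ∞ fun y => F (t, y) :=
    hF.comp (contDiff_const.prodMk contDiff_id)
  have hu (j : Fin 3) : ContDiff ℝ ∞ fun y => tslice us t y j := hslice (hus' j)
  have hb (j : Fin 3) : ContDiff ℝ ∞ fun y => tslice Bs t y j := hslice (hBs' j)
  have hp : ContDiff ℝ ∞ fun y => pres (t, y) := hslice hpres
  have hU (j : Fin 3) : ContDiff ℝ ∞ fun y => helm α (tslice us t) y j :=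
    hslice ((hus' j).helmS_slice α)
  have hB (j : Fin 3) : ContDiff ℝ ∞ fun y => helm α (tslice Bs t) y j :=
    hslice ((hBs' j).helmS_slice α)
  have hdU : DifferentiableAt ℝ (fun s => helm α (tslice us s) x i) t :=
    ((hus' i).helmS_slice α).differentiableAt_slice t x
  have hdB : DifferentiableAt ℝ (fun s => helm α (tslice Bs s) x i) t :=
    ((hBs' i).helmS_slice α).differentiableAt_slice t x
  have hind : deriv (fun s => helm α (tslice Bs s) x i) t =
      helmS α (fun y => advect (tslice Bs t) (tslice us t) y i
        - advect (tslice us t) (tslice Bs t) y i) x := by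
    refine (deriv_helmS_slice (hBs' i) α t x).trans ?_
    congr 1
    funext y
    linear_combination hinduction t y i
  have hpress : gradS (fun y => pres (t, y)
        + (1 / 2) * normSq (tslice us t) y + (α ^ 2 / 2) * gradNormSq (tslice us t) y
        + (1 / 2) * helmS α (normSq (tslice Bs t)) y
        + (α ^ 2 / 2) * gradNormSq (tslice Bs t) y) x i =
      gradS (fun y => pres (t, y)) x i +
        gradS (fun y => (1 / 2) * normSq (tslice us t) y + (α ^ 2 / 2) * gradNormSq (tslice us t) y
          + (1 / 2) * helmS α (normSq (tslice Bs t)) y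
          + (α ^ 2 / 2) * gradNormSq (tslice Bs t) y) x i := by
    simp only [add_assoc]
    refine pd_add i x hp ?_
    simp only [normSq_eq, gradNormSq, helmS, lapS, grad, Matrix.of_apply]
    fun_prop
  rw [deriv_fun_add hdU (hdB.const_mul ε), deriv_const_mul ε hdB, hind, hpress,
    elsasser_gradient_identity hu hb]
  erw [advect_sub_add (u := tslice us t) (b := tslice Bs t) hU hB]
  rw [divM_add_smul]
  · linear_combination hmotion t x i
      + ε * helmS_advect_sub_advect hu hb (hdivu t) (hdivB t) α x i
      - advect (tslice Bs t) (helm α (tslice Bs t)) x i * hε2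
  all_goals
    intro k l
    simp only [grad, Matrix.mul_apply, Matrix.sub_apply, Matrix.add_apply,
      Matrix.transpose_apply, Matrix.of_apply]
    fun_prop
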